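/- Closure of Büchi SNWA under eventualities: for every Büchi SNWA A over Σ there exist Büchi SNWA A_+ and A_- over Σ, each of size linear in the size of A, such that L_p(A_+) = { (w,i) : (w,j) ∈ L_p(A) for some j ≥ i } and L_p(A_-) = { (w,i) : (w,j) ∈ L_p(A) for some j ≤ i }. -/

import Mathlib

/-- Directions for two-way automata: forward and backward moves. -/
inductive TDir where
  | fwd : TDir
  | bwd : TDir
deriving DecidableEq

/-- Positive boolean formulas over `α` (with `true` and `false` allowed). -/
inductive PosBool (α : Type) where
  | tt : PosBool α
  | ff : PosBool α
  | var : α → PosBool α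
  | and : PosBool α → PosBool α → PosBool α
  | or : PosBool α → PosBool α → PosBool α

/-- Satisfaction of a positive boolean formula by a set. -/
def PosBool.isSat {α : Type} : PosBool α → Set α → Prop
  | .tt, _ => True
  | .ff, _ => False
  | .var a, Y => a ∈ Y
  | .and f g, Y => PosBool.isSat f Y ∧ PosBool.isSat g Y
  | .or f g, Y => PosBool.isSat f Y ∨ PosBool.isSat g Y

/-- `Y` is a minimal model of `f`. -/
def PosBool.MinModel {α : Type} (f : PosBool α) (Y : Set α) : Prop :=
  PosBool.isSat f Y ∧ ∀ Z : Set α, Z ⊂ Y → ¬ PosBool.isSat f Z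

/-- The atom `a` occurs in the positive boolean formula. -/
def PosBool.occurs {α : Type} (a : α) : PosBool α → Prop
  | .tt => False
  | .ff => False
  | .var b => b = a
  | .and f g => PosBool.occurs a f ∨ PosBool.occurs a g
  | .or f g => PosBool.occurs a f ∨ PosBool.occurs a g

/-- The dual of a positive boolean formula (swap `∧`/`∨` and `true`/`false`). -/
def PosBool.dual {α : Type} : PosBool α → PosBool α
  | .tt => .ff
  | .ff => .tt
  | .var a => .var a
  | .and f g => .or (PosBool.dual f) (PosBool.dual g)
  | .or f g => .and (PosBool.dual f) (PosBool.dual g)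

/-- Kinds of strata of a two-way HAA. -/
inductive StratKind where
  | neg : StratKind
  | transient : StratKind
  | buchi : StratKind
  | cobuchi : StratKind
deriving DecidableEq

/-- Data of a two-way hesitant alternating automaton over the alphabet `Sig`:
states, initial state, transition function, backward acceptance condition, and a
strata family (components indexed by `I`, their kinds, acceptance sets and partial
order). -/
structure HAAData (Sig : Type) where
  Q : Type
  q0 : Q
  tr : Q → Sig → PosBool (TDir × Q)
  Fm : Set Q
  I : Type
  strat : Q → I
  kind : I → StratKind
  F : I → Set Q
  le : I → I → Prop

/-- Well-formedness of a two-way HAA: finitely many states; acceptance sets live in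
their components and are empty for negative/transient strata; `le` is a partial
order; moves go to `le`-smaller components, transient strata have no self-moves
(requirement R1); and self-moves are backward in negative strata and forward in all
other strata (requirement R2). -/
def HAAData.IsHAA {Sig : Type} (A : HAAData Sig) : Prop :=
  Finite A.Q ∧
  (∀ i, ∃ q, A.strat q = i) ∧
  (∀ i, A.F i ⊆ {q | A.strat q = i}) ∧
  (∀ i, A.kind i = StratKind.neg ∨ A.kind i = StratKind.transient → A.F i = ∅) ∧
  (∀ i, A.le i i) ∧
  (∀ i j k, A.le i j → A.le j k → A.le i k) ∧
  (∀ i j, A.le i j → A.le j i → i = j) ∧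
  (∀ q σ d q', PosBool.occurs (d, q') (A.tr q σ) → A.le (A.strat q') (A.strat q)) ∧
  (∀ q σ d q', PosBool.occurs (d, q') (A.tr q σ) →
      A.kind (A.strat q) = StratKind.transient → A.strat q' ≠ A.strat q) ∧
  (∀ q σ d q', PosBool.occurs (d, q') (A.tr q σ) → A.strat q' = A.strat q →
      ((A.kind (A.strat q) = StratKind.neg → d = TDir.bwd) ∧
       (A.kind (A.strat q) ≠ StratKind.neg → d = TDir.fwd)))

/-- The effect of a move `(d, ·)` taken at position `j`. -/
def moveEffect (d : TDir) (j : ℕ) : ℤ :=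
  match d with
  | .fwd => (j : ℤ) + 1
  | .bwd => (j : ℤ) - 1

/-- A run of a two-way HAA `A` over the word `w` with initial vertex `v0`: a directed
graph whose vertices live in `({-1} ∪ ℕ) × Q` and whose edges are consistent with
minimal models of the transition function. -/
structure HAARun {Sig : Type} (A : HAAData Sig) (w : ℕ → Sig) (v0 : ℤ × A.Q) where
  V : Set (ℤ × A.Q)
  Ed : ℤ × A.Q → ℤ × A.Q → Prop
  v0_mem : v0 ∈ V
  edge_mem_l : ∀ ⦃u v⦄, Ed u v → u ∈ V
  edge_mem_r : ∀ ⦃u v⦄, Ed u v → v ∈ V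
  lower : ∀ v ∈ V, (-1 : ℤ) ≤ v.1
  no_edge_stop : ∀ (q : A.Q) v, ¬ Ed ((-1 : ℤ), q) v
  consistent : ∀ (j : ℕ) (q : A.Q), ((j : ℤ), q) ∈ V →
    ∃ Y : Set (TDir × A.Q), PosBool.MinModel (A.tr q (w j)) Y ∧
      ∀ v', (Ed ((j : ℤ), q) v' ↔ ∃ d q', (d, q') ∈ Y ∧ v' = (moveEffect d j, q'))

/-- The infinite path `f` eventually gets trapped in the component `i`. -/
def HAAData.TrappedIn {Sig : Type} (A : HAAData Sig) (f : ℕ → ℤ × A.Q) (i : A.I) :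
    Prop :=
  ∃ N, ∀ k, N ≤ k → A.strat (f k).2 = i

/-- The infinite path `f` is accepting: it satisfies the Büchi (resp. coBüchi)
condition of the stratum in which it gets trapped. -/
def HAAData.PathAccepting {Sig : Type} (A : HAAData Sig) (f : ℕ → ℤ × A.Q) : Prop :=
  ∀ i, A.TrappedIn f i →
    (A.kind i = StratKind.buchi → ∀ N, ∃ k, N ≤ k ∧ (f k).2 ∈ A.F i) ∧
    (A.kind i = StratKind.cobuchi → ∃ N, ∀ k, N ≤ k → (f k).2 ∉ A.F i)

/-- A run is accepting if all its infinite paths are accepting and every vertex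
`(-1, q)` reachable from the initial vertex has `q` in the backward acceptance
condition. -/
def HAARun.Accepting {Sig : Type} {A : HAAData Sig} {w : ℕ → Sig} {v0 : ℤ × A.Q}
    (r : HAARun A w v0) : Prop :=
  (∀ f : ℕ → ℤ × A.Q, (∀ k, r.Ed (f k) (f (k + 1))) → A.PathAccepting f) ∧
  (∀ q : A.Q, Relation.ReflTransGen r.Ed v0 ((-1 : ℤ), q) → q ∈ A.Fm)

/-- The pointed language of a two-way HAA: `(w, i) ∈ L_p(A)` iff there is an
accepting `(i, q0)`-run of `A` over `w`. -/
def HAAData.Lp {Sig : Type} (A : HAAData Sig) (w : ℕ → Sig) (i : ℕ) : Prop :=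
  ∃ r : HAARun A w ((i : ℤ), A.q0), r.Accepting
/-- A Büchi simple two-way nondeterministic word automaton (SNWA) over `Sig`. -/
structure SNWA (Sig : Type) where
  Q : Type
  Q0 : Set Q
  ρ : Q → TDir → Sig → Set Q
  Fm : Set Q
  Fp : Set Q

/-- Acceptance of a pointed word `(w, i)` by a Büchi SNWA: starting at position `i`
in a common initial state, a forward copy runs over the suffix satisfying the Büchi
condition `Fp`, and a backward copy runs over the prefix down to position `-1`,
ending in `Fm`. -/
def SNWA.Accepts {Sig : Type} (A : SNWA Sig) (w : ℕ → Sig) (i : ℕ) : Prop :=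
  ∃ (f : ℕ → A.Q) (g : ℕ → A.Q) (pm : A.Q),
    f i ∈ A.Q0 ∧ g i = f i ∧
    (∀ h, i ≤ h → f (h + 1) ∈ A.ρ (f h) TDir.fwd (w h)) ∧
    (∀ h, h < i → g h ∈ A.ρ (g (h + 1)) TDir.bwd (w (h + 1))) ∧
    pm ∈ A.ρ (g 0) TDir.bwd (w 0) ∧ pm ∈ A.Fm ∧
    (∀ N, ∃ k, N ≤ k ∧ f k ∈ A.Fp)
namespace SNWA

variable {Sig : Type}

/-- There is an infinite forward run over the suffix of `w` at `i`, starting in `q` and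
satisfying the Büchi condition. -/
def FwdAccepts (A : SNWA Sig) (w : ℕ → Sig) (i : ℕ) (q : A.Q) : Prop :=
  ∃ f : ℕ → A.Q, f i = q ∧ (∀ h, i ≤ h → f (h + 1) ∈ A.ρ (f h) TDir.fwd (w h)) ∧
    ∀ N, ∃ k, N ≤ k ∧ f k ∈ A.Fp

/-- There is a backward run reading the prefix of `w` of length `n` from right to left,
starting in `q` and ending in `Fm`. -/
def BwdAccepts (A : SNWA Sig) (w : ℕ → Sig) : ℕ → A.Q → Prop
  | 0, q => q ∈ A.Fm
  | n + 1, q => ∃ r ∈ A.ρ q TDir.bwd (w n), A.BwdAccepts w n r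

theorem fwdAccepts_iff_succ (A : SNWA Sig) (w : ℕ → Sig) (i : ℕ) (q : A.Q) :
    A.FwdAccepts w i q ↔ ∃ r ∈ A.ρ q TDir.fwd (w i), A.FwdAccepts w (i + 1) r := by
  constructor
  · rintro ⟨f, rfl, hf, hb⟩
    exact ⟨f (i + 1), hf i le_rfl, f, rfl, fun h hh => hf h (by omega), hb⟩
  · rintro ⟨r, hr, f, rfl, hf, hb⟩
    refine ⟨Function.update f i q, by simp, fun h hh => ?_, fun N => ?_⟩
    · rcases hh.eq_or_lt with rfl | hlt
      · simpa using hr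
      · rw [Function.update_of_ne (by omega), Function.update_of_ne (by omega)]
        exact hf h hlt
    · obtain ⟨k, hk, hkF⟩ := hb (max N (i + 1))
      refine ⟨k, by omega, ?_⟩
      rwa [Function.update_of_ne (by omega)]

theorem bwdAccepts_succ_iff_exists_run (A : SNWA Sig) (w : ℕ → Sig) (i : ℕ) (q : A.Q) :
    A.BwdAccepts w (i + 1) q ↔ ∃ (g : ℕ → A.Q) (pm : A.Q), g i = q ∧
      (∀ h, h < i → g h ∈ A.ρ (g (h + 1)) TDir.bwd (w (h + 1))) ∧
      pm ∈ A.ρ (g 0) TDir.bwd (w 0) ∧ pm ∈ A.Fm := by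
  induction i generalizing q with
  | zero =>
    constructor
    · rintro ⟨r, hr, hF⟩
      exact ⟨fun _ => q, r, rfl, by simp, hr, hF⟩
    · rintro ⟨g, pm, rfl, -, hr, hF⟩
      exact ⟨pm, hr, hF⟩
  | succ i ih =>
    constructor
    · rintro ⟨r, hr, hB⟩
      obtain ⟨g, pm, rfl, hg, h0, hF⟩ := (ih r).1 hB
      refine ⟨Function.update g (i + 1) q, pm, by simp, fun h hh => ?_, ?_, hF⟩
      · rw [Function.update_of_ne (show h ≠ i + 1 by omega)]
        rcases (Nat.lt_succ_iff.1 hh).eq_or_lt with rfl | hlt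
        · simpa using hr
        · rw [Function.update_of_ne (by omega)]
          exact hg h hlt
      · rwa [Function.update_of_ne (by omega)]
    · rintro ⟨g, pm, rfl, hg, h0, hF⟩
      exact ⟨g i, hg i (by omega), (ih _).2 ⟨g, pm, rfl, fun h hh => hg h (by omega), h0, hF⟩⟩

theorem accepts_iff (A : SNWA Sig) (w : ℕ → Sig) (i : ℕ) :
    A.Accepts w i ↔ ∃ q ∈ A.Q0, A.FwdAccepts w i q ∧ A.BwdAccepts w (i + 1) q := by
  simp only [bwdAccepts_succ_iff_exists_run]
  constructor
  · rintro ⟨f, g, pm, h0, hg, hf, hb, hpm, hF, hB⟩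
    exact ⟨f i, h0, ⟨f, rfl, hf, hB⟩, g, pm, hg, hb, hpm, hF⟩
  · rintro ⟨q, h0, ⟨f, rfl, hf, hB⟩, g, pm, hg, hb, hpm, hF⟩
    exact ⟨f, g, pm, h0, hg, hf, hb, hpm, hF, hB⟩

/-- `φ` embeds the transition structure of `A` as a closed part of that of `B`. -/
structure IsEmbedding (A B : SNWA Sig) (φ : A.Q → B.Q) : Prop where
  injective : Function.Injective φ
  map_ρ : ∀ q d σ, B.ρ (φ q) d σ = φ '' A.ρ q d σ
  mem_Fm : ∀ q, φ q ∈ B.Fm ↔ q ∈ A.Fm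
  mem_Fp : ∀ q, φ q ∈ B.Fp ↔ q ∈ A.Fp

theorem IsEmbedding.bwdAccepts_iff {A B : SNWA Sig} {φ : A.Q → B.Q} (hφ : IsEmbedding A B φ)
    (w : ℕ → Sig) (n : ℕ) (q : A.Q) : B.BwdAccepts w n (φ q) ↔ A.BwdAccepts w n q := by
  induction n generalizing q with
  | zero => exact hφ.mem_Fm q
  | succ n ih => simp [BwdAccepts, hφ.map_ρ, ih]

theorem IsEmbedding.fwdAccepts_iff {A B : SNWA Sig} {φ : A.Q → B.Q} (hφ : IsEmbedding A B φ)
    (w : ℕ → Sig) (i : ℕ) (q : A.Q) : B.FwdAccepts w i (φ q) ↔ A.FwdAccepts w i q := by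
  constructor
  · rintro ⟨f, hi, hf, hb⟩
    have hlift : ∀ h, ∃ a, i ≤ h → φ a = f h := by
      intro h
      by_cases hh : i ≤ h
      · induction h, hh using Nat.le_induction with
        | base => exact ⟨q, fun _ => hi.symm⟩
        | succ h hh ih =>
          obtain ⟨a, ha⟩ := ih
          have := hf h hh
          rw [← ha hh, hφ.map_ρ] at this
          obtain ⟨b, -, hb⟩ := this
          exact ⟨b, fun _ => hb⟩
      · exact ⟨q, fun h' => absurd h' hh⟩
    choose g hg using hlift
    refine ⟨g, hφ.injective ((hg i le_rfl).trans hi), fun h hh => ?_, fun N => ?_⟩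
    · have := hf h hh
      rwa [← hg h hh, ← hg (h + 1) (by omega), hφ.map_ρ, hφ.injective.mem_set_image] at this
    · obtain ⟨k, hk, hkF⟩ := hb (max N i)
      rw [← hg k (by omega), hφ.mem_Fp] at hkF
      exact ⟨k, by omega, hkF⟩
  · rintro ⟨f, rfl, hf, hb⟩
    refine ⟨φ ∘ f, rfl, fun h hh => ?_, fun N => ?_⟩
    · simpa [hφ.map_ρ] using Set.mem_image_of_mem φ (hf h hh)
    · obtain ⟨k, hk, hkF⟩ := hb N
      exact ⟨k, hk, (hφ.mem_Fp _).2 hkF⟩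

/-- The automaton for forward eventualities. A state `Sum.inl q` behaves like `q`. In state
`Sum.inr r`, the forward copy is guessing a backward run of `A` in reverse, and `r` is the
state which that run reaches after reading the current letter. -/
abbrev eventuallyFwd (A : SNWA Sig) : SNWA Sig where
  Q := A.Q ⊕ A.Q
  Q0 := Set.range Sum.inr
  ρ
    | .inl q, d, σ => Sum.inl '' A.ρ q d σ
    | .inr r, .bwd, _ => {Sum.inl r}
    | .inr r, .fwd, σ => Sum.inr '' {s | r ∈ A.ρ s TDir.bwd σ} ∪
        Sum.inl '' {q | ∃ s ∈ A.Q0, r ∈ A.ρ s TDir.bwd σ ∧ q ∈ A.ρ s TDir.fwd σ}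
  Fm := Sum.inl '' A.Fm
  Fp := Sum.inl '' A.Fp

/-- The automaton for backward eventualities. A state `Sum.inl q` behaves like `q`. In state
`Sum.inr (Sum.inl q)`, the backward copy is guessing a forward run of `A` in reverse, and `q`
is the state which that run reaches after reading the current letter. The states
`Sum.inr (Sum.inr q)` start such a guess. -/
abbrev eventuallyBwd (A : SNWA Sig) : SNWA Sig where
  Q := A.Q ⊕ A.Q ⊕ A.Q
  Q0 := Sum.inl '' A.Q0 ∪ Set.range (Sum.inr ∘ Sum.inr)
  ρ
    | .inl q, d, σ => Sum.inl '' A.ρ q d σ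
    | .inr (.inl _), .fwd, _ => ∅
    | .inr (.inl q), .bwd, σ => (Sum.inr ∘ Sum.inl) '' {s | q ∈ A.ρ s TDir.fwd σ} ∪
        Sum.inl '' {r | ∃ s ∈ A.Q0, q ∈ A.ρ s TDir.fwd σ ∧ r ∈ A.ρ s TDir.bwd σ}
    | .inr (.inr q), .fwd, σ => Sum.inl '' A.ρ q TDir.fwd σ
    | .inr (.inr q), .bwd, _ => {Sum.inr (Sum.inl q)}
  Fm := Sum.inl '' A.Fm
  Fp := Sum.inl '' A.Fp

theorem isEmbedding_eventuallyFwd (A : SNWA Sig) :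
    IsEmbedding A A.eventuallyFwd (Sum.inl : A.Q → A.Q ⊕ A.Q) where
  injective := Sum.inl_injective
  map_ρ _ _ _ := rfl
  mem_Fm _ := Sum.inl_injective.mem_set_image
  mem_Fp _ := Sum.inl_injective.mem_set_image

theorem isEmbedding_eventuallyBwd (A : SNWA Sig) :
    IsEmbedding A A.eventuallyBwd (Sum.inl : A.Q → A.Q ⊕ A.Q ⊕ A.Q) where
  injective := Sum.inl_injective
  map_ρ _ _ _ := rfl
  mem_Fm _ := Sum.inl_injective.mem_set_image
  mem_Fp _ := Sum.inl_injective.mem_set_image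

theorem eventuallyFwd_fwdAccepts_inr_iff (A : SNWA Sig) (w : ℕ → Sig) (i : ℕ) (r : A.Q) :
    A.eventuallyFwd.FwdAccepts w i (Sum.inr r : A.Q ⊕ A.Q) ↔
      ∃ s, r ∈ A.ρ s TDir.bwd (w i) ∧
        (A.eventuallyFwd.FwdAccepts w (i + 1) (Sum.inr s : A.Q ⊕ A.Q) ∨
          s ∈ A.Q0 ∧ A.FwdAccepts w i s) := by
  rw [fwdAccepts_iff_succ]
  constructor
  · rintro ⟨_, ⟨s, hs, rfl⟩ | ⟨q, ⟨s, hs0, hs, hq⟩, rfl⟩, hacc⟩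
    · exact ⟨s, hs, .inl hacc⟩
    · exact ⟨s, hs, .inr ⟨hs0, (A.fwdAccepts_iff_succ w i s).2
        ⟨q, hq, (A.isEmbedding_eventuallyFwd.fwdAccepts_iff w _ q).1 hacc⟩⟩⟩
  · rintro ⟨s, hs, hacc | ⟨hs0, hacc⟩⟩
    · exact ⟨_, .inl ⟨s, hs, rfl⟩, hacc⟩
    · obtain ⟨q, hq, hacc⟩ := (A.fwdAccepts_iff_succ w i s).1 hacc
      exact ⟨_, .inr ⟨q, ⟨s, hs0, hs, hq⟩, rfl⟩,
        (A.isEmbedding_eventuallyFwd.fwdAccepts_iff w _ q).2 hacc⟩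

theorem eventuallyFwd_accepts_iff_exists (A : SNWA Sig) (w : ℕ → Sig) (i : ℕ) :
    A.eventuallyFwd.Accepts w i ↔ ∃ r : A.Q,
      A.eventuallyFwd.FwdAccepts w i (Sum.inr r : A.Q ⊕ A.Q) ∧ A.BwdAccepts w i r := by
  rw [accepts_iff]
  constructor
  · rintro ⟨_, ⟨r, rfl⟩, hf, _, rfl, hb⟩
    exact ⟨r, hf, (A.isEmbedding_eventuallyFwd.bwdAccepts_iff w i r).1 hb⟩
  · rintro ⟨r, hf, hb⟩
    exact ⟨_, ⟨r, rfl⟩, hf, _, rfl, (A.isEmbedding_eventuallyFwd.bwdAccepts_iff w i r).2 hb⟩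

theorem eventuallyFwd_accepts_of_accepts (A : SNWA Sig) (w : ℕ → Sig) {i j : ℕ} (hij : i ≤ j)
    (hj : A.Accepts w j) : A.eventuallyFwd.Accepts w i := by
  simp only [eventuallyFwd_accepts_iff_exists]
  induction hij using Nat.decreasingInduction with
  | self =>
    obtain ⟨q, hq, hf, r, hr, hb⟩ := (A.accepts_iff w j).1 hj
    exact ⟨r, (A.eventuallyFwd_fwdAccepts_inr_iff w j r).2 ⟨q, hr, .inr ⟨hq, hf⟩⟩, hb⟩
  | of_succ k _ ih =>
    obtain ⟨s, hf, r, hr, hb⟩ := ih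
    exact ⟨r, (A.eventuallyFwd_fwdAccepts_inr_iff w k r).2 ⟨s, hr, .inl hf⟩, hb⟩

theorem exists_accepts_of_eventuallyFwd_run (A : SNWA Sig) (w : ℕ → Sig)
    (f : ℕ → A.Q ⊕ A.Q) (n i : ℕ) (r q : A.Q) (hr : f i = Sum.inr r)
    (hf : ∀ h, i ≤ h → f (h + 1) ∈ A.eventuallyFwd.ρ (f h) TDir.fwd (w h))
    (hacc : ∀ N, ∃ k, N ≤ k ∧ f k ∈ A.eventuallyFwd.Fp)
    (hb : A.BwdAccepts w i r) (hq : f (i + n) = Sum.inl q) :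
    ∃ j, i ≤ j ∧ A.Accepts w j := by
  induction n generalizing i r with
  | zero => simp [hr] at hq
  | succ n ih =>
    have hstep := hf i le_rfl
    rw [hr] at hstep
    obtain ⟨s, hs, hfs⟩ | ⟨p, ⟨s, hs0, hs, hp⟩, hfp⟩ := hstep
    · obtain ⟨j, hij, hj⟩ := ih (i + 1) s hfs.symm (fun h hh => hf h (by omega)) ⟨r, hs, hb⟩
        (by rw [← hq]; congr 1; omega)
      exact ⟨j, by omega, hj⟩
    · refine ⟨i, le_rfl, (A.accepts_iff w i).2 ⟨s, hs0, ?_, r, hs, hb⟩⟩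
      exact (A.fwdAccepts_iff_succ w i s).2 ⟨p, hp,
        (A.isEmbedding_eventuallyFwd.fwdAccepts_iff w _ p).1
          ⟨f, hfp.symm, fun h hh => hf h (by omega), hacc⟩⟩

theorem eventuallyFwd_accepts_iff (A : SNWA Sig) (w : ℕ → Sig) (i : ℕ) :
    A.eventuallyFwd.Accepts w i ↔ ∃ j, i ≤ j ∧ A.Accepts w j := by
  constructor
  · rw [eventuallyFwd_accepts_iff_exists]
    rintro ⟨r, ⟨f, hr, hf, hacc⟩, hb⟩
    obtain ⟨k, hk, q, -, hq⟩ := hacc i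
    exact A.exists_accepts_of_eventuallyFwd_run w f (k - i) i r q hr hf hacc hb
      (by rw [hq]; congr 1; omega)
  · rintro ⟨j, hij, hj⟩
    exact A.eventuallyFwd_accepts_of_accepts w hij hj

theorem eventuallyBwd_bwdAccepts_succ_iff (A : SNWA Sig) (w : ℕ → Sig) (i : ℕ) (q : A.Q) :
    A.eventuallyBwd.BwdAccepts w (i + 1) (Sum.inr (Sum.inl q) : A.Q ⊕ A.Q ⊕ A.Q) ↔
      ∃ s, q ∈ A.ρ s TDir.fwd (w i) ∧
        (A.eventuallyBwd.BwdAccepts w i (Sum.inr (Sum.inl s) : A.Q ⊕ A.Q ⊕ A.Q) ∨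
          s ∈ A.Q0 ∧ A.BwdAccepts w (i + 1) s) := by
  constructor
  · rintro ⟨_, ⟨s, hs, rfl⟩ | ⟨r, ⟨s, hs0, hs, hr⟩, rfl⟩, hb⟩
    · exact ⟨s, hs, .inl hb⟩
    · exact ⟨s, hs, .inr ⟨hs0, r, hr, (A.isEmbedding_eventuallyBwd.bwdAccepts_iff w i r).1 hb⟩⟩
  · rintro ⟨s, hs, hb | ⟨hs0, r, hr, hb⟩⟩
    · exact ⟨_, .inl ⟨s, hs, rfl⟩, hb⟩
    · exact ⟨_, .inr ⟨r, ⟨s, hs0, hs, hr⟩, rfl⟩,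
        (A.isEmbedding_eventuallyBwd.bwdAccepts_iff w i r).2 hb⟩

theorem exists_eventuallyBwd_bwdAccepts_iff (A : SNWA Sig) (w : ℕ → Sig) (i : ℕ) :
    (∃ q : A.Q, A.FwdAccepts w i q ∧
      A.eventuallyBwd.BwdAccepts w i (Sum.inr (Sum.inl q) : A.Q ⊕ A.Q ⊕ A.Q)) ↔
      ∃ j, j < i ∧ A.Accepts w j := by
  induction i with
  | zero => simp [BwdAccepts]
  | succ i ih =>
    constructor
    · rintro ⟨q, hf, hb⟩
      obtain ⟨s, hs, hb⟩ := (A.eventuallyBwd_bwdAccepts_succ_iff w i q).1 hb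
      have hfs := (A.fwdAccepts_iff_succ w i s).2 ⟨q, hs, hf⟩
      rcases hb with hb | ⟨hs0, hb⟩
      · obtain ⟨j, hj, hacc⟩ := ih.1 ⟨s, hfs, hb⟩
        exact ⟨j, by omega, hacc⟩
      · exact ⟨i, by omega, (A.accepts_iff w i).2 ⟨s, hs0, hfs, hb⟩⟩
    · rintro ⟨j, hj, hacc⟩
      obtain ⟨s, hfs, hs⟩ : ∃ s, A.FwdAccepts w i s ∧
          (A.eventuallyBwd.BwdAccepts w i (Sum.inr (Sum.inl s) : A.Q ⊕ A.Q ⊕ A.Q) ∨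
            s ∈ A.Q0 ∧ A.BwdAccepts w (i + 1) s) := by
        rcases (Nat.lt_succ_iff.1 hj).eq_or_lt with rfl | hlt
        · obtain ⟨s, hs0, hfs, hb⟩ := (A.accepts_iff w j).1 hacc
          exact ⟨s, hfs, .inr ⟨hs0, hb⟩⟩
        · obtain ⟨s, hfs, hb⟩ := ih.2 ⟨j, hlt, hacc⟩
          exact ⟨s, hfs, .inl hb⟩
      obtain ⟨q, hq, hf⟩ := (A.fwdAccepts_iff_succ w i s).1 hfs
      exact ⟨q, hf, (A.eventuallyBwd_bwdAccepts_succ_iff w i q).2 ⟨s, hq, hs⟩⟩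

theorem eventuallyBwd_fwdAccepts_inr_inr_iff (A : SNWA Sig) (w : ℕ → Sig) (i : ℕ) (q : A.Q) :
    A.eventuallyBwd.FwdAccepts w i (Sum.inr (Sum.inr q) : A.Q ⊕ A.Q ⊕ A.Q) ↔
      A.FwdAccepts w i q :=
  (A.eventuallyBwd.fwdAccepts_iff_succ w i _).trans <|
    (A.eventuallyBwd.fwdAccepts_iff_succ w i (Sum.inl q)).symm.trans <|
    A.isEmbedding_eventuallyBwd.fwdAccepts_iff w i q

theorem eventuallyBwd_accepts_iff (A : SNWA Sig) (w : ℕ → Sig) (i : ℕ) :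
    A.eventuallyBwd.Accepts w i ↔ ∃ j, j ≤ i ∧ A.Accepts w j := by
  have hE := A.isEmbedding_eventuallyBwd
  rw [accepts_iff]
  constructor
  · rintro ⟨_, ⟨q, hq, rfl⟩ | ⟨q, rfl⟩, hf, hb⟩
    · exact ⟨i, le_rfl, (A.accepts_iff w i).2
        ⟨q, hq, (hE.fwdAccepts_iff w i q).1 hf, (hE.bwdAccepts_iff w _ q).1 hb⟩⟩
    · obtain ⟨_, rfl, hb⟩ := hb
      obtain ⟨j, hj, hacc⟩ := (A.exists_eventuallyBwd_bwdAccepts_iff w i).1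
        ⟨q, (A.eventuallyBwd_fwdAccepts_inr_inr_iff w i q).1 hf, hb⟩
      exact ⟨j, hj.le, hacc⟩
  · rintro ⟨j, hj, hacc⟩
    rcases hj.eq_or_lt with rfl | hlt
    · obtain ⟨q, hq, hf, hb⟩ := (A.accepts_iff w j).1 hacc
      exact ⟨_, .inl ⟨q, hq, rfl⟩, (hE.fwdAccepts_iff w j q).2 hf,
        (hE.bwdAccepts_iff w _ q).2 hb⟩
    · obtain ⟨q, hf, hb⟩ := (A.exists_eventuallyBwd_bwdAccepts_iff w i).2 ⟨j, hlt, hacc⟩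
      exact ⟨_, .inr ⟨q, rfl⟩, (A.eventuallyBwd_fwdAccepts_inr_inr_iff w i q).2 hf, _, rfl, hb⟩

end SNWA

/-- **Closure of Büchi SNWA under eventualities**: there is a constant `c` such that
for every Büchi SNWA `A` there are Büchi SNWA `A_+` and `A_-`, each with at most
`c · |A|` states, accepting the pointed words `(w, i)` such that `(w, j) ∈ L_p(A)`
for some `j ≥ i` (resp. for some `j ≤ i`). -/
theorem snwa_eventualities (Sig : Type) :
    ∃ c : ℕ, ∀ A : SNWA Sig, Finite A.Q →
      ∃ Ap Am : SNWA Sig,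
        (Finite Ap.Q ∧ Nat.card Ap.Q ≤ c * Nat.card A.Q) ∧
        (Finite Am.Q ∧ Nat.card Am.Q ≤ c * Nat.card A.Q) ∧
        (∀ (w : ℕ → Sig) (i : ℕ), (Ap.Accepts w i ↔ ∃ j, i ≤ j ∧ A.Accepts w j)) ∧
        (∀ (w : ℕ → Sig) (i : ℕ), (Am.Accepts w i ↔ ∃ j, j ≤ i ∧ A.Accepts w j)) := by
  refine ⟨3, fun A hA => ⟨A.eventuallyFwd, A.eventuallyBwd, ⟨?_, ?_⟩, ⟨?_, ?_⟩,
    A.eventuallyFwd_accepts_iff, A.eventuallyBwd_accepts_iff⟩⟩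
  · exact inferInstanceAs (Finite (A.Q ⊕ A.Q))
  · change Nat.card (A.Q ⊕ A.Q) ≤ _
    rw [Nat.card_sum]
    omega
  · exact inferInstanceAs (Finite (A.Q ⊕ A.Q ⊕ A.Q))
  · change Nat.card (A.Q ⊕ A.Q ⊕ A.Q) ≤ _
    rw [Nat.card_sum, Nat.card_sum]
    omega
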